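/- arXiv:1901.05380 — 5 statements merged into one kernel-verified Lean document; each statement's English description precedes it below -/
import Mathlib

section
/- Let 0 < α ≤ 2, τ > 0 and x > 0. Then ∫_ℝ |f_τ(x,s)|^α ds = (1 − e^{−xτ})^α/(α x^{1+α}) + x^{−α} ∫_0^τ (1 − e^{−xs})^α ds, and this quantity is bounded above by (1/α)·min(τ^α/x, 1/x^{1+α}) + min(τ/x^α, τ^{1+α}). -/
open MeasureTheory Filter Set

/-- `f_τ(x,s) := ∫_0^τ e^{−x(t−s)} 1(s ≤ t) dt`. -/
noncomputable def fker (τ x s : ℝ) : ℝ :=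
  ∫ t in Set.Ioc (0:ℝ) τ, if s ≤ t then Real.exp (-x * (t - s)) else 0

lemma setIntegral_exp_neg_mul_sub {x : ℝ} (hx : x ≠ 0) (s : ℝ) {a b : ℝ} (hab : a ≤ b) :
    ∫ t in Set.Ioc a b, Real.exp (-x * (t - s))
      = (Real.exp (-x * (a - s)) - Real.exp (-x * (b - s))) / x := by
  rw [← intervalIntegral.integral_of_le hab]
  have hderiv : ∀ t ∈ Set.uIcc a b,
      HasDerivAt (fun t => -Real.exp (-x * (t - s)) / x) (Real.exp (-x * (t - s))) t := by
    intro t _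
    refine (((((hasDerivAt_id' t).sub_const s).const_mul (-x)).exp.neg).div_const x).congr_deriv ?_
    field_simp
  rw [intervalIntegral.integral_eq_sub_of_hasDerivAt hderiv
    (Continuous.intervalIntegrable (by fun_prop) _ _)]
  ring

lemma fker_of_nonpos {τ x s : ℝ} (hτ : 0 ≤ τ) (hx : x ≠ 0) (hs : s ≤ 0) :
    fker τ x s = (1 - Real.exp (-x * τ)) / x * Real.exp (x * s) := by
  have h : fker τ x s = ∫ t in Set.Ioc (0:ℝ) τ, Real.exp (-x * (t - s)) :=
    setIntegral_congr_fun measurableSet_Ioc fun t ht => if_pos (hs.trans ht.1.le)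
  rw [h, setIntegral_exp_neg_mul_sub hx s hτ,
    show -x * (0 - s) = x * s by ring, show -x * (τ - s) = -x * τ + x * s by ring, Real.exp_add]
  ring

lemma fker_of_mem_Ioc {τ x s : ℝ} (hx : x ≠ 0) (hs : s ∈ Set.Ioc 0 τ) :
    fker τ x s = (1 - Real.exp (-x * (τ - s))) / x := by
  have h : fker τ x s = ∫ t in Set.Ioc (0:ℝ) τ,
      (Set.Ici s).indicator (fun t => Real.exp (-x * (t - s))) t := by
    simp only [fker, Set.indicator_apply, Set.mem_Ici]
  have hset : Set.Ioc 0 τ ∩ Set.Ici s = Set.Icc s τ := by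
    ext t
    simp only [Set.mem_inter_iff, Set.mem_Ioc, Set.mem_Ici, Set.mem_Icc]
    exact ⟨fun ht => ⟨ht.2, ht.1.2⟩, fun ht => ⟨⟨hs.1.trans_le ht.1, ht.2⟩, ht.1⟩⟩
  rw [h, setIntegral_indicator measurableSet_Ici, hset, integral_Icc_eq_integral_Ioc,
    setIntegral_exp_neg_mul_sub hx s hs.2]
  simp

lemma fker_of_lt {τ x s : ℝ} (hs : τ < s) : fker τ x s = 0 :=
  setIntegral_eq_zero_of_forall_eq_zero fun _ ht => if_neg (ht.2.trans_lt hs).not_ge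

lemma one_sub_exp_neg_mul_nonneg {x u : ℝ} (hx : 0 ≤ x) (hu : 0 ≤ u) :
    0 ≤ 1 - Real.exp (-x * u) :=
  sub_nonneg.2 (Real.exp_le_one_iff.2 (by nlinarith [mul_nonneg hx hu]))

lemma abs_fker_rpow_of_nonpos {τ x s : ℝ} (α : ℝ) (hτ : 0 ≤ τ) (hx : 0 < x) (hs : s ≤ 0) :
    |fker τ x s| ^ α = ((1 - Real.exp (-x * τ)) / x) ^ α * Real.exp (α * x * s) := by
  have h0 := div_nonneg (one_sub_exp_neg_mul_nonneg hx.le hτ) hx.le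
  rw [fker_of_nonpos hτ hx.ne' hs, abs_of_nonneg (mul_nonneg h0 (Real.exp_nonneg _)),
    Real.mul_rpow h0 (Real.exp_nonneg _), ← Real.exp_mul]
  ring_nf

lemma abs_fker_rpow_of_mem_Ioc {τ x s : ℝ} (α : ℝ) (hx : 0 < x) (hs : s ∈ Set.Ioc 0 τ) :
    |fker τ x s| ^ α = x ^ (-α) * (1 - Real.exp (-x * (τ - s))) ^ α := by
  have h0 := one_sub_exp_neg_mul_nonneg hx.le (sub_nonneg.2 hs.2)
  rw [fker_of_mem_Ioc hx.ne' hs, abs_of_nonneg (div_nonneg h0 hx.le), Real.div_rpow h0 hx.le,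
    Real.rpow_neg hx.le]
  ring

lemma continuous_one_sub_exp_rpow {α : ℝ} (hα : 0 ≤ α) (x : ℝ) :
    Continuous fun s : ℝ => (1 - Real.exp (-x * s)) ^ α :=
  Continuous.rpow_const (by fun_prop) fun _ => Or.inr hα

lemma integral_abs_fker_rpow {α τ x : ℝ} (hα : 0 < α) (hτ : 0 ≤ τ) (hx : 0 < x) :
    ∫ s : ℝ, |fker τ x s| ^ α
      = (1 - Real.exp (-x * τ)) ^ α / (α * x ^ (1 + α))
        + x ^ (-α) * ∫ s in Set.Ioc (0:ℝ) τ, (1 - Real.exp (-x * s)) ^ α := by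
  have hneg : Set.EqOn (fun s => |fker τ x s| ^ α)
      (fun s => ((1 - Real.exp (-x * τ)) / x) ^ α * Real.exp (α * x * s)) (Set.Iic 0) :=
    fun s hs => abs_fker_rpow_of_nonpos α hτ hx hs
  have hmid : Set.EqOn (fun s => |fker τ x s| ^ α)
      (fun s => x ^ (-α) * (1 - Real.exp (-x * (τ - s))) ^ α) (Set.Ioc 0 τ) :=
    fun s hs => abs_fker_rpow_of_mem_Ioc α hx hs
  have hright : ∀ s, τ < s → |fker τ x s| ^ α = 0 := fun s hs => by
    rw [fker_of_lt hs, abs_zero, Real.zero_rpow hα.ne']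
  have hcont := continuous_one_sub_exp_rpow hα.le x
  have ineg : IntegrableOn (fun s => |fker τ x s| ^ α) (Set.Iic 0) :=
    IntegrableOn.congr_fun ((integrableOn_exp_mul_Iic (mul_pos hα hx) 0).const_mul _) hneg.symm
      measurableSet_Iic
  have imid : IntegrableOn (fun s => |fker τ x s| ^ α) (Set.Ioc 0 τ) :=
    (((hcont.comp (continuous_const.sub continuous_id)).const_mul _).integrableOn_Ioc).congr_fun
      hmid.symm measurableSet_Ioc
  have iright : IntegrableOn (fun s => |fker τ x s| ^ α) (Set.Ioi τ) :=
    integrableOn_zero.congr_fun (fun s hs => (hright s hs).symm) measurableSet_Ioi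
  have ipos : IntegrableOn (fun s => |fker τ x s| ^ α) (Set.Ioi 0) := by
    rw [← Set.Ioc_union_Ioi_eq_Ioi hτ]
    exact imid.union iright
  have hpos : ∫ s in Set.Ioi 0, |fker τ x s| ^ α = ∫ s in Set.Ioc 0 τ, |fker τ x s| ^ α :=
    setIntegral_eq_of_subset_of_forall_sdiff_eq_zero measurableSet_Ioi Set.Ioc_subset_Ioi_self
      fun s hs => hright s (not_le.1 fun h => hs.2 ⟨hs.1, h⟩)
  rw [← intervalIntegral.integral_Iic_add_Ioi ineg ipos, hpos,
    setIntegral_congr_fun measurableSet_Iic hneg, setIntegral_congr_fun measurableSet_Ioc hmid,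
    integral_const_mul, integral_const_mul, integral_exp_mul_Iic (mul_pos hα hx)]
  congr 1
  · rw [mul_zero, Real.exp_zero, Real.div_rpow (one_sub_exp_neg_mul_nonneg hx.le hτ) hx.le,
      Real.rpow_add hx, Real.rpow_one]
    have := Real.rpow_pos_of_pos hx α
    field_simp
  · rw [← intervalIntegral.integral_of_le hτ, ← intervalIntegral.integral_of_le hτ,
      intervalIntegral.integral_comp_sub_left (fun u => (1 - Real.exp (-x * u)) ^ α)]
    simp

lemma one_sub_exp_rpow_le {α x u : ℝ} (hα : 0 ≤ α) (hx : 0 ≤ x) (hu : 0 ≤ u) :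
    (1 - Real.exp (-x * u)) ^ α ≤ min ((x * u) ^ α) 1 := by
  have h0 := one_sub_exp_neg_mul_nonneg hx hu
  refine le_min (Real.rpow_le_rpow h0 ?_ hα) (Real.rpow_le_one h0 ?_ hα)
  · linarith [Real.add_one_le_exp (-x * u)]
  · linarith [Real.exp_pos (-x * u)]

lemma setIntegral_one_sub_exp_rpow_le {α τ x : ℝ} (hα : 0 ≤ α) (hτ : 0 ≤ τ) (hx : 0 ≤ x) :
    ∫ s in Set.Ioc (0:ℝ) τ, (1 - Real.exp (-x * s)) ^ α ≤ τ * min ((x * τ) ^ α) 1 := by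
  calc ∫ s in Set.Ioc (0:ℝ) τ, (1 - Real.exp (-x * s)) ^ α
      ≤ ∫ _ in Set.Ioc (0:ℝ) τ, min ((x * τ) ^ α) 1 := by
        refine setIntegral_mono_on (continuous_one_sub_exp_rpow hα x).integrableOn_Ioc
          continuous_const.integrableOn_Ioc measurableSet_Ioc fun s hs => ?_
        refine (one_sub_exp_rpow_le hα hx hs.1.le).trans (min_le_min_right 1 ?_)
        exact Real.rpow_le_rpow (mul_nonneg hx hs.1.le) (mul_le_mul_of_nonneg_left hs.2 hx) hα
    _ = τ * min ((x * τ) ^ α) 1 := by simp [hτ]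

/-- the exact value and upper bound (4.12)/(4.11) for `∫_ℝ |f_τ(x,s)|^α ds`. -/
theorem stmt_1 (α τ x : ℝ) (hα0 : 0 < α) (hα2 : α ≤ 2) (hτ : 0 < τ) (hx : 0 < x) :
    (∫ s : ℝ, |fker τ x s| ^ α)
      = (1 - Real.exp (-x * τ)) ^ α / (α * x ^ (1 + α))
        + x ^ (-α) * (∫ s in Set.Ioc (0:ℝ) τ, (1 - Real.exp (-x * s)) ^ α) ∧
    (∫ s : ℝ, |fker τ x s| ^ α)
      ≤ (1 / α) * min (τ ^ α / x) (1 / x ^ (1 + α)) + min (τ / x ^ α) (τ ^ (1 + α)) := by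
  refine ⟨integral_abs_fker_rpow hα0 hτ.le hx, ?_⟩
  rw [integral_abs_fker_rpow hα0 hτ.le hx]
  have hxα := Real.rpow_pos_of_pos hx α
  have hx1 : x ^ (1 + α) = x * x ^ α := by rw [Real.rpow_add hx, Real.rpow_one]
  have hτ1 : τ ^ (1 + α) = τ * τ ^ α := by rw [Real.rpow_add hτ, Real.rpow_one]
  have hmin : min ((x * τ) ^ α) 1 = x ^ α * min (τ ^ α) (1 / x ^ α) := by
    rw [mul_min_of_nonneg _ _ hxα.le, Real.mul_rpow hx.le hτ.le, mul_one_div_cancel hxα.ne']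
  have hfst : min (τ ^ α / x) (1 / x ^ (1 + α)) = min (τ ^ α) (1 / x ^ α) / x := by
    rw [← min_div_div_right hx.le, hx1, div_div, mul_comm x]
  have hsnd : min (τ / x ^ α) (τ ^ (1 + α)) = τ * min (τ ^ α) (1 / x ^ α) := by
    rw [mul_min_of_nonneg _ _ hτ.le, hτ1, mul_one_div, min_comm]
  rw [hfst, hsnd]
  refine add_le_add ?_ ?_
  · calc (1 - Real.exp (-x * τ)) ^ α / (α * x ^ (1 + α))
        ≤ min ((x * τ) ^ α) 1 / (α * x ^ (1 + α)) := by
          gcongr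
          exact one_sub_exp_rpow_le hα0.le hx.le hτ.le
      _ = 1 / α * (min (τ ^ α) (1 / x ^ α) / x) := by
          rw [hmin, hx1]
          field_simp
  · calc x ^ (-α) * ∫ s in Set.Ioc (0:ℝ) τ, (1 - Real.exp (-x * s)) ^ α
        ≤ x ^ (-α) * (τ * min ((x * τ) ^ α) 1) := by
          gcongr
          exact setIntegral_one_sub_exp_rpow_le hα0.le hτ.le hx.le
      _ = τ * min (τ ^ α) (1 / x ^ α) := by
          rw [hmin, Real.rpow_neg hx.le]
          field_simp
end

section
/- Let 1 < α < 2, 0 < β < α and let p satisfy β < p < α·min(1, β). Then there exists a constant C > 0, independent of τ, such that for all τ > 0, ∫_0^∞ (∫_ℝ |f_τ(x,s)|^α ds)^{p/α} x^{β−1} dx ≤ C τ^{p + p/α − β}. -/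
open MeasureTheory Filter Set

theorem fker_nonneg (τ x s : ℝ) : 0 ≤ fker τ x s :=
  integral_nonneg fun t => by
    dsimp only
    split_ifs <;> positivity

theorem fker_eq_zero_of_lt {τ s : ℝ} (x : ℝ) (h : τ < s) : fker τ x s = 0 := by
  refine setIntegral_eq_zero_of_forall_eq_zero fun t ht => ?_
  rw [if_neg (by linarith [ht.2])]

theorem fker_le_mul_exp {τ x : ℝ} (s : ℝ) (hτ : 0 < τ) (hx : 0 < x) :
    fker τ x s ≤ τ * Real.exp (x * min s 0) := by
  have key : ∀ t ∈ Ioc (0:ℝ) τ,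
      ‖(if s ≤ t then Real.exp (-x * (t - s)) else 0 : ℝ)‖ ≤ Real.exp (x * min s 0) := by
    intro t ht
    split_ifs with h
    · rw [Real.norm_of_nonneg (Real.exp_pos _).le]
      have : s - t ≤ min s 0 := le_min (by linarith [ht.1]) (by linarith)
      exact Real.exp_le_exp.2 (by nlinarith)
    · simpa using (Real.exp_pos _).le
  have := norm_setIntegral_le_of_norm_le_const (μ := volume) (by simp) key
  rw [measureReal_def, Real.volume_Ioc, sub_zero, ENNReal.toReal_ofReal hτ.le, mul_comm] at this
  exact (le_abs_self _).trans this

theorem fker_le_inv_mul_exp {x : ℝ} (τ s : ℝ) (hx : 0 < x) :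
    fker τ x s ≤ x⁻¹ * Real.exp (x * min s 0) := by
  have hI : IntegrableOn (fun t => Real.exp (x * s) * Real.exp (-x * t)) (Ioi (max s 0)) :=
    (integrableOn_exp_mul_Ioi (by linarith) _).const_mul _
  have hv : ∫ t in Ioi (max s 0), Real.exp (x * s) * Real.exp (-x * t)
      = x⁻¹ * Real.exp (x * min s 0) := by
    rw [integral_const_mul, integral_exp_mul_Ioi (by linarith)]
    have h : x * min s 0 = x * s + -x * max s 0 := by
      linear_combination x * min_add_max s 0
    rw [h, Real.exp_add]
    field_simp
  rw [← hv, ← integral_Ici_eq_integral_Ioi, ← integral_indicator measurableSet_Ici, fker,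
    ← integral_indicator measurableSet_Ioc]
  refine integral_mono_of_nonneg (.of_forall fun t => ?_)
    ((integrable_indicator_iff measurableSet_Ici).2
      ((integrableOn_Ici_iff_integrableOn_Ioi enorm_ne_top).2 hI))
    (.of_forall fun t => ?_)
  · refine indicator_nonneg (fun t _ => ?_) t
    split_ifs <;> positivity
  · have hnn : 0 ≤ (Ici (max s 0)).indicator
        (fun t => Real.exp (x * s) * Real.exp (-x * t)) t :=
      indicator_nonneg (fun _ _ => by positivity) t
    by_cases ht : t ∈ Ioc 0 τ
    · simp only [indicator_of_mem ht]
      split_ifs with h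
      · rw [indicator_of_mem (show t ∈ Ici (max s 0) from max_le h ht.1.le), ← Real.exp_add]
        exact Real.exp_le_exp.2 (by linarith)
      · exact hnn
    · simpa only [indicator_of_notMem ht] using hnn

theorem integral_abs_fker_rpow_le {α τ x m : ℝ} (hα : 1 ≤ α) (hτ : 0 < τ) (hx : 0 < x)
    (hm : 0 ≤ m) (h : ∀ s, fker τ x s ≤ m * Real.exp (x * min s 0)) :
    ∫ s, |fker τ x s| ^ α ≤ m ^ α * (x⁻¹ + τ) := by
  have hmα : 0 ≤ m ^ α := Real.rpow_nonneg hm _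
  have h1 : Integrable ((Iic (0:ℝ)).indicator fun s => m ^ α * Real.exp (x * s)) :=
    (integrable_indicator_iff measurableSet_Iic).2
      ((integrableOn_exp_mul_Iic hx 0).const_mul _)
  have h2 : Integrable ((Ioc (0:ℝ) τ).indicator fun _ => m ^ α) :=
    (integrable_indicator_iff measurableSet_Ioc).2 (by simp)
  have hv : ∫ s, ((Iic (0:ℝ)).indicator (fun s => m ^ α * Real.exp (x * s)) s
      + (Ioc (0:ℝ) τ).indicator (fun _ => m ^ α) s) = m ^ α * (x⁻¹ + τ) := by
    rw [integral_add h1 h2, integral_indicator measurableSet_Iic,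
      integral_indicator measurableSet_Ioc, integral_const_mul, integral_exp_mul_Iic hx]
    simp [hτ.le]
    ring
  rw [← hv]
  refine integral_mono_of_nonneg (.of_forall fun s => by positivity) (h1.add h2)
    (.of_forall fun s => ?_)
  dsimp only
  have hb : |fker τ x s| ^ α ≤ m ^ α * Real.exp (x * min s 0) := by
    rw [abs_of_nonneg (fker_nonneg _ _ _)]
    refine (Real.rpow_le_rpow (fker_nonneg _ _ _) (h s) (by linarith)).trans ?_
    rw [Real.mul_rpow hm (Real.exp_pos _).le, ← Real.exp_mul]
    have : x * min s 0 ≤ 0 := mul_nonpos_of_nonneg_of_nonpos hx.le (min_le_right _ _)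
    exact mul_le_mul_of_nonneg_left (Real.exp_le_exp.2 (by nlinarith)) hmα
  rcases le_or_gt s 0 with hs | hs
  · rw [indicator_of_mem (show s ∈ Iic (0:ℝ) from hs), indicator_of_notMem (by simp [hs]), add_zero]
    rwa [min_eq_left hs] at hb
  · rw [indicator_of_notMem (by simpa using hs), zero_add]
    rcases le_or_gt s τ with hs' | hs'
    · rw [indicator_of_mem (show s ∈ Ioc 0 τ from ⟨hs, hs'⟩)]
      simpa [min_eq_right hs.le] using hb
    · rw [fker_eq_zero_of_lt x hs', abs_zero, Real.zero_rpow (by linarith)]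
      exact indicator_nonneg (fun _ _ => hmα) s

theorem integral_abs_fker_rpow_rpow_mul_le {α β p τ x m b : ℝ} (hα : 1 ≤ α) (hp : 0 ≤ p)
    (hτ : 0 < τ) (hx : 0 < x) (hm : 0 ≤ m)
    (h : ∀ s, fker τ x s ≤ m * Real.exp (x * min s 0)) (hb : 0 ≤ b) (hxb : x⁻¹ + τ ≤ 2 * b) :
    (∫ s, |fker τ x s| ^ α) ^ (p / α) * x ^ (β - 1)
      ≤ 2 ^ (p / α) * (m ^ p * b ^ (p / α) * x ^ (β - 1)) := by
  have hα0 : 0 < α := by linarith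
  have hmα : 0 ≤ m ^ α := Real.rpow_nonneg hm _
  have hle : (∫ s, |fker τ x s| ^ α) ^ (p / α) ≤ (m ^ α * (2 * b)) ^ (p / α) := by
    refine Real.rpow_le_rpow (integral_nonneg fun s => by positivity) ?_ (by positivity)
    exact (integral_abs_fker_rpow_le hα hτ hx hm h).trans (by gcongr)
  rw [Real.mul_rpow hmα (by positivity), Real.mul_rpow (by norm_num) hb, ← Real.rpow_mul hm,
    mul_div_cancel₀ p hα0.ne'] at hle
  refine (mul_le_mul_of_nonneg_right hle (by positivity)).trans (le_of_eq (by ring))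

/-- the moment-integral bound (4.12) used to prove that the
intermediate process `Z_{α,β}` is well defined and a.s. continuous. -/
theorem stmt_4 (α β p : ℝ) (hα1 : 1 < α) (hα2 : α < 2) (hβ0 : 0 < β) (hβα : β < α)
    (hp1 : β < p) (hp2 : p < α * min 1 β) :
    ∃ C : ℝ, 0 < C ∧ ∀ τ : ℝ, 0 < τ →
      (∫ x in Set.Ioi (0:ℝ), (∫ s : ℝ, |fker τ x s| ^ α) ^ (p / α) * x ^ (β - 1))
        ≤ C * τ ^ (p + p / α - β) := by
  have hα0 : 0 < α := by linarith
  have hpα : p / α < β := by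
    rw [div_lt_iff₀ hα0, mul_comm]
    exact hp2.trans_le (by gcongr; exact min_le_right _ _)
  have hd1 : 0 < β - p / α := by linarith
  have hd2 : 0 < p - β := by linarith
  refine ⟨2 ^ (p / α) * ((β - p / α)⁻¹ + (p - β)⁻¹), by positivity, fun τ hτ => ?_⟩
  have hT : 0 < τ⁻¹ := inv_pos.2 hτ
  set F : ℝ → ℝ := fun x => (∫ s : ℝ, |fker τ x s| ^ α) ^ (p / α) * x ^ (β - 1)
  set g₁ : ℝ → ℝ := fun x => 2 ^ (p / α) * (τ ^ p * x ^ (β - p / α - 1)) with hg₁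
  set g₂ : ℝ → ℝ := fun x => 2 ^ (p / α) * (τ ^ (p / α) * x ^ (-(p - β) - 1)) with hg₂
  have hI₁ : IntegrableOn g₁ (Ioc 0 τ⁻¹) :=
    (((intervalIntegrable_iff_integrableOn_Ioc_of_le hT.le).1
      (intervalIntegral.intervalIntegrable_rpow' (by linarith))).const_mul _).const_mul _
  have hI₂ : IntegrableOn g₂ (Ioi τ⁻¹) :=
    ((integrableOn_Ioi_rpow_of_lt (by linarith) hT).const_mul _).const_mul _
  have hv₁ : ∫ x in Ioc 0 τ⁻¹, g₁ x = 2 ^ (p / α) * ((β - p / α)⁻¹ * τ ^ (p + p / α - β)) := by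
    rw [hg₁, integral_const_mul, integral_const_mul, ← intervalIntegral.integral_of_le hT.le,
      integral_rpow (Or.inl (by linarith)), sub_add_cancel, Real.zero_rpow hd1.ne',
      Real.inv_rpow hτ.le, ← Real.rpow_neg hτ.le,
      show p + p / α - β = p + -(β - p / α) by ring, Real.rpow_add hτ]
    ring
  have hv₂ : ∫ x in Ioi τ⁻¹, g₂ x = 2 ^ (p / α) * ((p - β)⁻¹ * τ ^ (p + p / α - β)) := by
    rw [hg₂, integral_const_mul, integral_const_mul, integral_Ioi_rpow_of_lt (by linarith) hT,
      sub_add_cancel, Real.inv_rpow hτ.le, ← Real.rpow_neg hτ.le, neg_neg,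
      show p + p / α - β = p / α + (p - β) by ring, Real.rpow_add hτ, neg_div_neg_eq]
    ring
  have hle₁ : ∀ x ∈ Ioc 0 τ⁻¹, F x ≤ g₁ x := by
    intro x hx
    have hx0 : 0 < x := hx.1
    have hτx : τ ≤ x⁻¹ := (le_inv_comm₀ hx0 hτ).1 hx.2
    refine (integral_abs_fker_rpow_rpow_mul_le hα1.le (by linarith) hτ hx0 hτ.le
      (fun s => fker_le_mul_exp s hτ hx0) (inv_pos.2 hx0).le (by linarith)).trans (le_of_eq ?_)
    rw [Real.inv_rpow hx0.le, ← Real.rpow_neg hx0.le, mul_assoc (τ ^ p), ← Real.rpow_add hx0]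
    simp only [hg₁]
    ring_nf
  have hle₂ : ∀ x ∈ Ioi τ⁻¹, F x ≤ g₂ x := by
    intro x hx
    have hx0 : 0 < x := hT.trans hx
    have hxτ : x⁻¹ ≤ τ := inv_le_of_inv_le₀ hτ (le_of_lt hx)
    refine (integral_abs_fker_rpow_rpow_mul_le hα1.le (by linarith) hτ hx0 (inv_pos.2 hx0).le
      (fun s => fker_le_inv_mul_exp τ s hx0) hτ.le (by linarith)).trans (le_of_eq ?_)
    rw [Real.inv_rpow hx0.le, ← Real.rpow_neg hx0.le, mul_comm (x ^ (-p)), mul_assoc (τ ^ (p / α)),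
      ← Real.rpow_add hx0]
    simp only [hg₂]
    ring_nf
  have hle : ∀ x ∈ Ioi (0:ℝ), F x ≤ (Ioc 0 τ⁻¹).indicator g₁ x + (Ioi τ⁻¹).indicator g₂ x := by
    intro x hx
    rcases le_or_gt x τ⁻¹ with h | h
    · rw [indicator_of_mem (show x ∈ Ioc 0 τ⁻¹ from ⟨hx, h⟩),
        indicator_of_notMem (by simpa using h), add_zero]
      exact hle₁ x ⟨hx, h⟩
    · rw [indicator_of_notMem (fun h' => absurd h'.2 (not_le.2 h)),
        indicator_of_mem (show x ∈ Ioi τ⁻¹ from h), zero_add]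
      exact hle₂ x h
  have hJ₁ := (integrable_indicator_iff measurableSet_Ioc).2 hI₁
  have hJ₂ := (integrable_indicator_iff measurableSet_Ioi).2 hI₂
  calc ∫ x in Ioi (0:ℝ), F x
      ≤ ∫ x in Ioi (0:ℝ), ((Ioc 0 τ⁻¹).indicator g₁ x + (Ioi τ⁻¹).indicator g₂ x) := by
        refine integral_mono_of_nonneg ?_ (hJ₁.add hJ₂).integrableOn
          (ae_restrict_of_forall_mem measurableSet_Ioi hle)
        refine ae_restrict_of_forall_mem measurableSet_Ioi fun x hx => ?_
        exact mul_nonneg (Real.rpow_nonneg (integral_nonneg fun s => by positivity) _)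
          (Real.rpow_nonneg (le_of_lt hx) _)
    _ = (∫ x in Ioc 0 τ⁻¹, g₁ x) + ∫ x in Ioi τ⁻¹, g₂ x := by
        rw [integral_add hJ₁.integrableOn hJ₂.integrableOn, setIntegral_indicator measurableSet_Ioc,
          setIntegral_indicator measurableSet_Ioi, inter_eq_right.2 Ioc_subset_Ioi_self,
          inter_eq_right.2 (Ioi_subset_Ioi hT.le)]
    _ = 2 ^ (p / α) * ((β - p / α)⁻¹ + (p - β)⁻¹) * τ ^ (p + p / α - β) := by
        rw [hv₁, hv₂]
        ring
end

section
/- Let 0 < α ≤ 2, a ∈ [0,1) and n ∈ ℕ. Then Σ_{s ≤ 0} |c_n(a,s)|^α ≤ (1/(min(α,1)(1−a))) · min(n, 1/(1−a))^α and Σ_{s=1}^n |c_n(a,s)|^α ≤ n · min(n, 1/(1−a))^α. -/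
open MeasureTheory Filter Set

/-- `c_n(a,s) := Σ_{t=1}^n a^{t−s} 1(s ≤ t)` for `a ∈ [0,1)`, `n ∈ ℕ`, `s ∈ ℤ`. -/
noncomputable def cAR (n : ℕ) (a : ℝ) (s : ℤ) : ℝ :=
  ∑ t ∈ Finset.Icc 1 n, if s ≤ (t : ℤ) then a ^ ((t : ℤ) - s).toNat else 0

theorem cAR_nonneg {a : ℝ} (ha0 : 0 ≤ a) (n : ℕ) (s : ℤ) : 0 ≤ cAR n a s := by
  unfold cAR
  refine Finset.sum_nonneg fun t _ => ?_
  split_ifs <;> positivity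

theorem cAR_le_min {a : ℝ} (ha0 : 0 ≤ a) (ha1 : a < 1) (n : ℕ) (s : ℤ) :
    cAR n a s ≤ min (n : ℝ) (1 / (1 - a)) := by
  refine le_min ?_ ?_
  · calc cAR n a s ≤ ∑ _t ∈ Finset.Icc 1 n, (1 : ℝ) := by
          refine Finset.sum_le_sum fun t _ => ?_
          split_ifs
          · exact pow_le_one₀ ha0 ha1.le
          · exact zero_le_one
      _ = n := by simp
  · have hinj : Set.InjOn (fun t : ℕ => ((t : ℤ) - s).toNat)
        ((Finset.Icc 1 n).filter fun t : ℕ => s ≤ (t : ℤ)) := by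
      intro x hx y hy hxy
      simp only [Finset.coe_filter, Set.mem_ofPred_eq] at hx hy hxy
      omega
    rw [cAR, ← Finset.sum_filter, one_div,
      ← Finset.sum_image (f := fun k : ℕ => a ^ k) hinj]
    exact sum_le_hasSum _ (fun k _ => pow_nonneg ha0 k) (hasSum_geometric_of_lt_one ha0 ha1)

theorem cAR_neg_natCast (a : ℝ) (n k : ℕ) : cAR n a (-(k : ℤ)) = a ^ k * cAR n a 0 := by
  unfold cAR
  rw [Finset.mul_sum]
  refine Finset.sum_congr rfl fun t _ => ?_
  rw [if_pos (by omega), if_pos (by omega), ← pow_add]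
  congr 1
  omega

theorem min_one_mul_one_sub_le_one_sub_rpow {α a : ℝ} (hα0 : 0 < α) (ha0 : 0 ≤ a)
    (ha1 : a < 1) : min α 1 * (1 - a) ≤ 1 - a ^ α := by
  rcases le_total α 1 with h | h
  · have hb := rpow_one_add_le_one_add_mul_self (s := a - 1) (by linarith) hα0.le h
    rw [add_sub_cancel] at hb
    rw [min_eq_left h]
    linarith
  · have hb := Real.rpow_le_rpow_of_exponent_ge' ha0 ha1.le zero_le_one h
    rw [Real.rpow_one] at hb
    rw [min_eq_right h]
    linarith

theorem hasSum_abs_cAR_rpow_nonpos {α a : ℝ} (hα0 : 0 < α) (ha0 : 0 ≤ a) (ha1 : a < 1)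
    (n : ℕ) :
    HasSum (fun s : ℤ => if s ≤ 0 then |cAR n a s| ^ α else 0)
      ((1 - a ^ α)⁻¹ * cAR n a 0 ^ α) := by
  have hinj : Function.Injective fun k : ℕ => -(k : ℤ) := fun x y h => by
    simpa using h
  rw [← hinj.hasSum_iff]
  · have hg := (hasSum_geometric_of_lt_one (Real.rpow_nonneg ha0 α)
      (Real.rpow_lt_one ha0 ha1 hα0)).mul_right (cAR n a 0 ^ α)
    refine (congrArg (HasSum · _) (funext fun k => ?_)).mpr hg
    have hk : -(k : ℤ) ≤ 0 := by omega
    simp only [Function.comp_apply, if_pos hk]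
    rw [abs_of_nonneg (cAR_nonneg ha0 n _), cAR_neg_natCast,
      Real.mul_rpow (pow_nonneg ha0 k) (cAR_nonneg ha0 n 0), Real.rpow_pow_comm ha0]
  · intro s hs
    refine if_neg fun h => hs ⟨s.natAbs, ?_⟩
    dsimp only
    omega

/-- the elementary inequalities (4.2) for the AR(1) coefficient sums. -/
theorem stmt_5 (α : ℝ) (hα0 : 0 < α) (hα2 : α ≤ 2) (a : ℝ) (ha0 : 0 ≤ a) (ha1 : a < 1)
    (n : ℕ) :
    (∑' s : ℤ, if s ≤ 0 then |cAR n a s| ^ α else 0)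
      ≤ (1 / (min α 1 * (1 - a))) * (min (n : ℝ) (1 / (1 - a))) ^ α ∧
    (∑ s ∈ Finset.Icc (1 : ℤ) (n : ℤ), |cAR n a s| ^ α)
      ≤ (n : ℝ) * (min (n : ℝ) (1 / (1 - a))) ^ α := by
  have hrpow (s : ℤ) : |cAR n a s| ^ α ≤ (min (n : ℝ) (1 / (1 - a))) ^ α := by
    rw [abs_of_nonneg (cAR_nonneg ha0 n s)]
    exact Real.rpow_le_rpow (cAR_nonneg ha0 n s) (cAR_le_min ha0 ha1 n s) hα0.le
  constructor
  · have hpos : 0 < min α 1 * (1 - a) :=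
      mul_pos (lt_min hα0 one_pos) (sub_pos.2 ha1)
    have h0 := hrpow 0
    rw [abs_of_nonneg (cAR_nonneg ha0 n 0)] at h0
    rw [(hasSum_abs_cAR_rpow_nonpos hα0 ha0 ha1 n).tsum_eq, ← one_div]
    exact mul_le_mul
      (one_div_le_one_div_of_le hpos (min_one_mul_one_sub_le_one_sub_rpow hα0 ha0 ha1))
      h0 (Real.rpow_nonneg (cAR_nonneg ha0 n 0) α) (one_div_pos.2 hpos).le
  · calc _ ≤ ∑ _s ∈ Finset.Icc (1 : ℤ) (n : ℤ), (min (n : ℝ) (1 / (1 - a))) ^ α :=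
          Finset.sum_le_sum fun s _ => hrpow s
      _ = _ := by simp
end

section
/- Let 0 < α ≤ 2, d ∈ ℕ and θ₁, …, θ_d ∈ ℝ. For y > 1 define K̃(y) := (1/y) Σ_{s ∈ ℤ} |Σ_{t=1}^d θ_t (1 − 1/y)^{t−s} 1(s ≤ t)|^α. Then lim_{y→∞} K̃(y) = ∫_{−∞}^0 |Σ_{t=1}^d θ_t e^{s}|^α ds = (1/α) |Σ_{t=1}^d θ_t|^α. -/
open MeasureTheory Filter Set

theorem integral_abs_mul_exp_rpow_Iic {α : ℝ} (hα : 0 < α) (c : ℝ) :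
    ∫ s in Set.Iic (0 : ℝ), |c * Real.exp s| ^ α = (1 / α) * |c| ^ α := by
  have h : ∀ s : ℝ, |c * Real.exp s| ^ α = |c| ^ α * Real.exp (α * s) := fun s => by
    rw [abs_mul, Real.abs_exp, Real.mul_rpow (abs_nonneg _) (Real.exp_pos _).le,
      ← Real.exp_mul, mul_comm s]
  simp only [h]
  rw [integral_const_mul, integral_exp_mul_Iic hα]
  simp [mul_comm]

/-- The derivative of `u ↦ 1 - (1 - u) ^ α` at `0` is `α`, in the form of an inverted slope. -/
theorem tendsto_mul_inv_one_sub_one_sub_rpow {α : ℝ} (hα : 0 < α) :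
    Tendsto (fun u : ℝ => u * (1 - (1 - u) ^ α)⁻¹) (nhdsWithin 0 (Set.Ioi 0)) (nhds α⁻¹) := by
  have hd : HasDerivAt (fun u : ℝ => 1 - (1 - u) ^ α) α 0 := by
    have h1 : HasDerivAt (fun u : ℝ => 1 - u) (-1) 0 := by
      simpa using (hasDerivAt_id (0 : ℝ)).const_sub 1
    have h2 := (h1.rpow_const (p := α) (Or.inl (by norm_num))).const_sub 1
    simpa using h2
  have h := (hd.tendsto_slope_zero_right).inv₀ hα.ne'
  refine h.congr fun u => ?_
  simp [mul_comm]

/-- The series of `α`-th powers of the geometrically weighted tails, split into the finitely many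
nonnegative indices and a geometric series over the negative ones. -/
theorem hasSum_abs_sum_geometric_rpow {α : ℝ} (hα : 0 < α) (d : ℕ) (θ : ℤ → ℝ) {r : ℝ}
    (hr0 : 0 < r) (hr1 : r < 1) :
    HasSum (fun s : ℤ => |∑ t ∈ Finset.Icc (1 : ℤ) (d : ℤ),
        (if s ≤ t then θ t * r ^ (t - s).toNat else 0)| ^ α)
      ((∑ n ∈ Finset.range (d + 1), |∑ t ∈ Finset.Icc (1 : ℤ) (d : ℤ),
        (if (n : ℤ) ≤ t then θ t * r ^ (t - (n : ℤ)).toNat else 0)| ^ α) +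
      |∑ t ∈ Finset.Icc (1 : ℤ) (d : ℤ), θ t * r ^ (t + 1).toNat| ^ α * (1 - r ^ α)⁻¹) := by
  refine HasSum.of_nat_of_neg_add_one ?_ ?_
  · refine hasSum_sum_of_ne_finset_zero fun n hn => ?_
    rw [Finset.sum_eq_zero, abs_zero, Real.zero_rpow hα.ne']
    intro t ht
    rw [Finset.mem_Icc] at ht
    rw [Finset.mem_range] at hn
    exact if_neg (by omega)
  · have hg := (hasSum_geometric_of_lt_one (Real.rpow_nonneg hr0.le α)
      (Real.rpow_lt_one hr0.le hr1 hα)).mul_left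
        (|∑ t ∈ Finset.Icc (1 : ℤ) (d : ℤ), θ t * r ^ (t + 1).toNat| ^ α)
    refine hg.congr_fun fun n => ?_
    have h : ∑ t ∈ Finset.Icc (1 : ℤ) (d : ℤ),
        (if -((n : ℤ) + 1) ≤ t then θ t * r ^ (t - -((n : ℤ) + 1)).toNat else 0) =
        (∑ t ∈ Finset.Icc (1 : ℤ) (d : ℤ), θ t * r ^ (t + 1).toNat) * r ^ n := by
      rw [Finset.sum_mul]
      refine Finset.sum_congr rfl fun t ht => ?_
      rw [Finset.mem_Icc] at ht
      rw [if_pos (by omega), mul_assoc, ← pow_add]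
      congr 2
      omega
    rw [h, abs_mul, Real.mul_rpow (abs_nonneg _) (abs_nonneg _), abs_of_pos (pow_pos hr0 n),
      ← Real.rpow_natCast, ← Real.rpow_natCast, ← Real.rpow_mul hr0.le, ← Real.rpow_mul hr0.le,
      mul_comm (n : ℝ)]

/-- the limit (4.5) used in the proof of the iterated-limit result for
`β = 1` in Theorem 2.1: with
`K̃(y) := (1/y) Σ_{s ∈ ℤ} |Σ_{t=1}^d θ_t (1 − 1/y)^{t−s} 1(s ≤ t)|^α`, one has
`lim_{y→∞} K̃(y) = ∫_{−∞}^0 |Σ_{t=1}^d θ_t e^s|^α ds = (1/α)|Σ_{t=1}^d θ_t|^α`. -/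
theorem stmt_7 (α : ℝ) (hα0 : 0 < α) (hα2 : α ≤ 2) (d : ℕ) (hd : 0 < d) (θ : ℤ → ℝ) :
    Filter.Tendsto (fun y : ℝ =>
        (1 / y) * ∑' s : ℤ,
          |∑ t ∈ Finset.Icc (1 : ℤ) (d : ℤ),
            (if s ≤ t then θ t * (1 - 1 / y) ^ (t - s).toNat else 0)| ^ α)
      Filter.atTop
      (nhds (∫ s in Set.Iic (0:ℝ), |(∑ t ∈ Finset.Icc (1 : ℤ) (d : ℤ), θ t) * Real.exp s| ^ α)) ∧
    (∫ s in Set.Iic (0:ℝ), |(∑ t ∈ Finset.Icc (1 : ℤ) (d : ℤ), θ t) * Real.exp s| ^ α)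
      = (1 / α) * |∑ t ∈ Finset.Icc (1 : ℤ) (d : ℤ), θ t| ^ α := by
  refine ⟨?_, integral_abs_mul_exp_rpow_Iic hα0 _⟩
  rw [integral_abs_mul_exp_rpow_Iic hα0]
  set F : ℝ → ℝ := fun u => ∑ n ∈ Finset.range (d + 1), |∑ t ∈ Finset.Icc (1 : ℤ) (d : ℤ),
    (if (n : ℤ) ≤ t then θ t * (1 - u) ^ (t - (n : ℤ)).toNat else 0)| ^ α with hF
  set A : ℝ → ℝ := fun u =>
    |∑ t ∈ Finset.Icc (1 : ℤ) (d : ℤ), θ t * (1 - u) ^ (t + 1).toNat| ^ α with hA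
  have hFc : Continuous F := by
    refine continuous_finsetSum _ fun n _ => Continuous.rpow_const ?_ fun _ => Or.inr hα0.le
    refine (continuous_finsetSum _ fun t _ => ?_).abs
    split_ifs <;> fun_prop
  have hAc : Continuous A :=
    Continuous.rpow_const (by fun_prop) fun _ => Or.inr hα0.le
  have hlim : Tendsto (fun u => u * F u + A u * (u * (1 - (1 - u) ^ α)⁻¹))
      (nhdsWithin 0 (Set.Ioi 0)) (nhds (0 * F 0 + A 0 * α⁻¹)) :=
    ((continuous_id.mul hFc).continuousAt.tendsto.mono_left nhdsWithin_le_nhds).add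
      ((hAc.continuousAt.tendsto.mono_left nhdsWithin_le_nhds).mul
        (tendsto_mul_inv_one_sub_one_sub_rpow hα0))
  have hval : 0 * F 0 + A 0 * α⁻¹ = (1 / α) * |∑ t ∈ Finset.Icc (1 : ℤ) (d : ℤ), θ t| ^ α := by
    simp [hA, mul_comm]
  rw [hval] at hlim
  refine (hlim.comp tendsto_inv_atTop_nhdsGT_zero).congr' ?_
  filter_upwards [eventually_gt_atTop 1] with y hy
  have hy1 : 1 / y < 1 := by rw [div_lt_one (by linarith)]; exact hy
  have hy0 : 0 < 1 / y := by positivity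
  rw [(hasSum_abs_sum_geometric_rpow hα0 d θ (r := 1 - 1 / y) (by linarith)
    (by linarith)).tsum_eq]
  simp only [Function.comp, hF, hA, one_div]
  ring
end

section
/- Let 1 < α ≤ 2, d ∈ ℕ, θ₁, …, θ_d ∈ ℝ, and let φ: [0,1) → [0,∞) be an integrable probability density with lim_{u↑1} φ(u) = ψ₁ > 0. For u ∈ [0,1), s ∈ ℤ set c(u,s) := Σ_{t=1}^d θ_t u^{t−s} 1(s ≤ t) and K(u) := (1−u) Σ_{s ∈ ℤ} |c(u,s)|^α. Then lim_{N→∞} N ∫_0^1 (exp(−K(u)/((1−u) N log N)) − 1) φ(u) du = −(ψ₁/α) |Σ_{t=1}^d θ_t|^α. -/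
open MeasureTheory Filter Set

/-- `c(u,s) := Σ_{t=1}^d θ_t u^{t−s} 1(s ≤ t)`. -/
noncomputable def cNA (d : ℕ) (θ : ℤ → ℝ) (u : ℝ) (s : ℤ) : ℝ :=
  ∑ t ∈ Finset.Icc (1 : ℤ) (d : ℤ), if s ≤ t then θ t * u ^ (t - s).toNat else 0

/-- `K(u) := (1−u) Σ_{s ∈ ℤ} |c(u,s)|^α`. -/
noncomputable def Kar (α : ℝ) (d : ℕ) (θ : ℤ → ℝ) (u : ℝ) : ℝ :=
  (1 - u) * ∑' s : ℤ, |cNA d θ u s| ^ α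

/-- `exp (-x) - 1 + x` is at most quadratic for nonnegative `x`. -/
lemma abs_exp_neg_sub_one_add_le_sq {x : ℝ} (hx : 0 ≤ x) : |Real.exp (-x) - 1 + x| ≤ x ^ 2 := by
  rcases le_total x 1 with h | h
  · have := Real.abs_exp_sub_one_sub_id_le (x := -x) (by rwa [abs_neg, abs_of_nonneg hx])
    simpa using this
  · have h1 : Real.exp (-x) ≤ 1 := Real.exp_le_one_iff.2 (by linarith)
    have h2 := Real.add_one_le_exp (-x)
    rw [abs_of_nonneg (by linarith)]
    nlinarith

lemma abs_exp_neg_sub_one_le {x : ℝ} (hx : 0 ≤ x) : |Real.exp (-x) - 1| ≤ min x 1 := by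
  have h1 : Real.exp (-x) ≤ 1 := Real.exp_le_one_iff.2 (by linarith)
  have h2 := Real.add_one_le_exp (-x)
  have h3 := Real.exp_pos (-x)
  rw [abs_of_nonpos (by linarith)]
  exact le_min (by linarith) (by linarith)

lemma integral_inv_one_sub {a δ : ℝ} (ha : 0 < a) (hδ : a ≤ δ) :
    ∫ u in (1 - δ)..(1 - a), (1 - u)⁻¹ = Real.log (δ / a) := by
  rw [intervalIntegral.integral_comp_sub_left (fun x => x⁻¹) 1]
  simp only [sub_sub_cancel]
  exact integral_inv_of_pos ha (ha.trans_le hδ)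

lemma continuousOn_one_sub_inv_pow {a δ : ℝ} (ha : 0 < a) (hδ : a ≤ δ) (n : ℕ) :
    ContinuousOn (fun u : ℝ => ((1 - u)⁻¹) ^ n) (uIcc (1 - δ) (1 - a)) := by
  rw [uIcc_of_le (by linarith)]
  refine ContinuousOn.pow (ContinuousOn.inv₀ (by fun_prop) fun u hu => ?_) n
  have := hu.2
  linarith

lemma integral_inv_one_sub_sq_le {a δ : ℝ} (ha : 0 < a) (hδ : a ≤ δ) :
    ∫ u in (1 - δ)..(1 - a), ((1 - u)⁻¹) ^ 2 ≤ a⁻¹ := by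
  have hderiv : ∀ u ∈ uIcc (1 - δ) (1 - a),
      HasDerivAt (fun u : ℝ => (1 - u)⁻¹) (((1 - u)⁻¹) ^ 2) u := by
    intro u hu
    rw [uIcc_of_le (by linarith)] at hu
    have hne : 1 - u ≠ 0 := by have := hu.2; linarith
    have h := ((hasDerivAt_id' u).const_sub 1).fun_inv hne
    rwa [neg_neg, one_div, ← inv_pow] at h
  rw [intervalIntegral.integral_eq_sub_of_hasDerivAt hderiv
    (continuousOn_one_sub_inv_pow ha hδ 2).intervalIntegrable]
  have : 0 < δ⁻¹ := inv_pos.2 (ha.trans_le hδ)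
  simp only [sub_sub_cancel]
  linarith

section Laplace

variable {K φ : ℝ → ℝ} {C : ℝ}

lemma integrableOn_exp_sub_one_mul
    (hKm : AEStronglyMeasurable K (volume.restrict (Ico 0 1)))
    (hK0 : ∀ u ∈ Ico (0 : ℝ) 1, 0 ≤ K u) (hφ : IntegrableOn φ (Ico 0 1))
    {a : ℝ} (ha : 0 ≤ a) :
    IntegrableOn (fun u => (Real.exp (-(a * (K u * (1 - u)⁻¹))) - 1) * φ u) (Ico 0 1) := by
  refine Integrable.bdd_mul (c := 1) hφ ?_ ?_
  · have h1 : AEStronglyMeasurable (fun u : ℝ => (1 - u)⁻¹) (volume.restrict (Ico 0 1)) :=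
      (measurable_const.sub measurable_id).inv.aestronglyMeasurable
    exact (Real.continuous_exp.comp_aestronglyMeasurable ((hKm.mul h1).const_mul a).neg).sub
      aestronglyMeasurable_const
  · filter_upwards [ae_restrict_mem measurableSet_Ico] with u hu
    have h1 : 0 ≤ (1 - u)⁻¹ := inv_nonneg.2 (by linarith [hu.2])
    exact (abs_exp_neg_sub_one_le (mul_nonneg ha (mul_nonneg (hK0 u hu) h1))).trans
      (min_le_right _ _)

lemma abs_integral_exp_sub_one_mul_add_le
    (hKm : AEStronglyMeasurable K (volume.restrict (Ico 0 1)))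
    (hK0 : ∀ u ∈ Ico (0 : ℝ) 1, 0 ≤ K u) (hKC : ∀ u ∈ Ico (0 : ℝ) 1, K u ≤ C)
    (hφ : IntegrableOn φ (Ico 0 1)) (hφ0 : ∀ u ∈ Ico (0 : ℝ) 1, 0 ≤ φ u)
    {a δ ε M l : ℝ} (ha : 0 < a) (haδ : a ≤ δ) (hδ : δ ≤ 1)
    (hM : ∀ u ∈ Ico (1 - δ) 1, φ u ≤ M) (hε : ∀ u ∈ Ico (1 - δ) 1, |K u * φ u - l| ≤ ε) :
    |(∫ u in Ico 0 1, (Real.exp (-(a * (K u * (1 - u)⁻¹))) - 1) * φ u) +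
        a * l * Real.log (δ / a)| ≤
      a * (C * δ⁻¹ * (∫ u in Ico 0 1, φ u) + M + M * C ^ 2 + ε * Real.log (δ / a)) := by
  set g : ℝ → ℝ := fun u => (Real.exp (-(a * (K u * (1 - u)⁻¹))) - 1) * φ u with hg
  have hgi : IntegrableOn g (Ico 0 1) := integrableOn_exp_sub_one_mul hKm hK0 hφ ha.le
  have hδ0 : 0 < δ := ha.trans_le haδ
  have hC : 0 ≤ C := (hK0 0 (by simp)).trans (hKC 0 (by simp))
  have hgI : IntervalIntegrable g volume 0 1 :=
    (intervalIntegrable_iff_integrableOn_Ico_of_le zero_le_one).2 hgi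
  have hφI : IntervalIntegrable φ volume 0 1 :=
    (intervalIntegrable_iff_integrableOn_Ico_of_le zero_le_one).2 hφ
  have sub : ∀ {f : ℝ → ℝ} {x y : ℝ}, IntervalIntegrable f volume 0 1 → 0 ≤ x → x ≤ y → y ≤ 1 →
      IntervalIntegrable f volume x y := fun hf hx hxy hy => hf.mono_set (by
    rw [uIcc_of_le hxy, uIcc_of_le zero_le_one]; exact Icc_subset_Icc hx hy)
  have hg1 := sub hgI le_rfl (by linarith : (0 : ℝ) ≤ 1 - δ) (by linarith)
  have hg2 := sub hgI (by linarith) (by linarith : 1 - δ ≤ 1 - a) (by linarith)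
  have hg3 := sub hgI (by linarith) (by linarith : 1 - a ≤ 1) le_rfl
  have hx0 : ∀ u ∈ Ico (0 : ℝ) 1, 0 ≤ a * (K u * (1 - u)⁻¹) := fun u hu =>
    mul_nonneg ha.le (mul_nonneg (hK0 u hu) (inv_nonneg.2 (by linarith [hu.2])))
  have Ico_eq : ∀ f : ℝ → ℝ, ∫ u in Ico 0 1, f u = ∫ u in (0 : ℝ)..1, f u := fun f => by
    rw [integral_Ico_eq_integral_Ioc, intervalIntegral.integral_of_le zero_le_one]
  rw [Ico_eq, Ico_eq, ← intervalIntegral.integral_add_adjacent_intervals (hg1.trans hg2) hg3,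
    ← intervalIntegral.integral_add_adjacent_intervals hg1 hg2]
  have far : |∫ u in (0 : ℝ)..(1 - δ), g u| ≤ a * (C * δ⁻¹ * ∫ u in (0 : ℝ)..1, φ u) := by
    have h1 : |∫ u in (0 : ℝ)..(1 - δ), g u| ≤
        ∫ u in (0 : ℝ)..(1 - δ), (a * (C * δ⁻¹)) * φ u := by
      rw [← Real.norm_eq_abs]
      refine intervalIntegral.norm_integral_le_of_norm_le (by linarith)
        (Eventually.of_forall fun u hu => ?_)
        ((sub hφI le_rfl (by linarith : (0 : ℝ) ≤ 1 - δ) (by linarith)).const_mul _)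
      have hu' : u ∈ Ico (0 : ℝ) 1 := ⟨hu.1.le, by linarith [hu.2]⟩
      rw [hg, Real.norm_eq_abs, abs_mul, abs_of_nonneg (hφ0 u hu')]
      refine mul_le_mul_of_nonneg_right (((abs_exp_neg_sub_one_le (hx0 u hu')).trans
        (min_le_left _ _)).trans ?_) (hφ0 u hu')
      have h2 : (1 - u)⁻¹ ≤ δ⁻¹ := inv_anti₀ hδ0 (by linarith [hu.2])
      have h3 : 0 ≤ (1 - u)⁻¹ := inv_nonneg.2 (by linarith [hu'.2])
      have := hKC u hu'
      gcongr
    have h2 : ∫ u in (0 : ℝ)..(1 - δ), φ u ≤ ∫ u in (0 : ℝ)..1, φ u := by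
      rw [← Ico_eq, intervalIntegral.integral_of_le (by linarith), ← integral_Ico_eq_integral_Ioc]
      refine setIntegral_mono_set hφ ?_ (Ico_subset_Ico_right (by linarith)).eventuallyLE
      filter_upwards [ae_restrict_mem measurableSet_Ico] with u hu using hφ0 u hu
    rw [intervalIntegral.integral_const_mul] at h1
    have h3 : 0 ≤ a * (C * δ⁻¹) := by positivity
    nlinarith [mul_le_mul_of_nonneg_left h2 h3]
  have near : |∫ u in (1 - a)..1, g u| ≤ a * M := by
    have h1 := intervalIntegral.norm_integral_le_of_norm_le (μ := volume) (f := g)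
      (g := fun _ => M) (a := 1 - a) (b := 1) (by linarith) ?_ (by simp)
    · simpa using h1
    · filter_upwards [compl_mem_ae_iff.2 (measure_singleton (1 : ℝ))] with u hne hu
      have hu1 : u < 1 := lt_of_le_of_ne hu.2 hne
      have hu' : u ∈ Ico (0 : ℝ) 1 := ⟨by linarith [hu.1], hu1⟩
      rw [hg, Real.norm_eq_abs, abs_mul, abs_of_nonneg (hφ0 u hu')]
      have h2 := (abs_exp_neg_sub_one_le (hx0 u hu')).trans (min_le_right _ _)
      have h3 := hM u ⟨by linarith [hu.1], hu1⟩
      nlinarith [hφ0 u hu']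
  have hinv : IntervalIntegrable (fun u : ℝ => (1 - u)⁻¹) volume (1 - δ) (1 - a) := by
    simpa using (continuousOn_one_sub_inv_pow ha haδ 1).intervalIntegrable
  have hinv2 : IntervalIntegrable (fun u : ℝ => ((1 - u)⁻¹) ^ 2) volume (1 - δ) (1 - a) :=
    (continuousOn_one_sub_inv_pow ha haδ 2).intervalIntegrable
  have mid : |(∫ u in (1 - δ)..(1 - a), g u) + a * l * Real.log (δ / a)| ≤
      a * (M * C ^ 2 + ε * Real.log (δ / a)) := by
    have h1 : |∫ u in (1 - δ)..(1 - a), (g u + a * l * (1 - u)⁻¹)| ≤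
        ∫ u in (1 - δ)..(1 - a), ((M * C ^ 2 * a ^ 2) * ((1 - u)⁻¹) ^ 2 +
          (a * ε) * (1 - u)⁻¹) := by
      rw [← Real.norm_eq_abs]
      refine intervalIntegral.norm_integral_le_of_norm_le (by linarith)
        (Eventually.of_forall fun u hu => ?_) ((hinv2.const_mul _).add (hinv.const_mul _))
      have hu1 : u < 1 := by linarith [hu.2]
      have hu' : u ∈ Ico (0 : ℝ) 1 := ⟨by linarith [hu.1], hu1⟩
      have huδ : u ∈ Ico (1 - δ) 1 := ⟨hu.1.le, hu1⟩
      have hi : 0 ≤ (1 - u)⁻¹ := inv_nonneg.2 (by linarith)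
      have hsq := abs_exp_neg_sub_one_add_le_sq (hx0 u hu')
      set x := a * (K u * (1 - u)⁻¹) with hx
      have hxC : x ≤ a * (C * (1 - u)⁻¹) := by
        have := hKC u hu'
        rw [hx]; gcongr
      have e : g u + a * l * (1 - u)⁻¹ =
          (Real.exp (-x) - 1 + x) * φ u - a * (1 - u)⁻¹ * (K u * φ u - l) := by
        rw [hg, hx]; ring
      rw [e, Real.norm_eq_abs]
      refine (abs_sub _ _).trans (add_le_add ?_ ?_)
      · rw [abs_mul, abs_of_nonneg (hφ0 u hu')]
        calc _ ≤ (a * (C * (1 - u)⁻¹)) ^ 2 * M :=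
              mul_le_mul (hsq.trans (pow_le_pow_left₀ (hx0 u hu') hxC 2)) (hM u huδ)
                (hφ0 u hu') (sq_nonneg _)
          _ = _ := by ring
      · rw [abs_mul, abs_of_nonneg (mul_nonneg ha.le hi)]
        calc _ ≤ a * (1 - u)⁻¹ * ε :=
              mul_le_mul_of_nonneg_left (hε u huδ) (mul_nonneg ha.le hi)
          _ = _ := by ring
    rw [intervalIntegral.integral_add hg2 (hinv.const_mul _),
      intervalIntegral.integral_add (hinv2.const_mul _) (hinv.const_mul _)] at h1
    simp only [intervalIntegral.integral_const_mul, integral_inv_one_sub ha haδ] at h1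
    refine h1.trans ?_
    have hM0 : 0 ≤ M := (hφ0 (1 - δ) ⟨by linarith, by linarith⟩).trans
      (hM (1 - δ) ⟨le_rfl, by linarith⟩)
    have h2 : M * C ^ 2 * a ^ 2 * (∫ u in (1 - δ)..(1 - a), ((1 - u)⁻¹) ^ 2) ≤
        M * C ^ 2 * a ^ 2 * a⁻¹ :=
      mul_le_mul_of_nonneg_left (integral_inv_one_sub_sq_le ha haδ) (by positivity)
    have h3 : M * C ^ 2 * a ^ 2 * a⁻¹ = a * (M * C ^ 2) := by field_simp
    linarith
  rw [abs_le] at *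
  constructor <;> linarith [far.1, far.2, near.1, near.2, mid.1, mid.2]

lemma tendsto_log_mul_log_div_log {δ : ℝ} (hδ : 0 < δ) :
    Tendsto (fun x : ℝ => Real.log (δ / (x * Real.log x)⁻¹) / Real.log x) atTop (nhds 1) := by
  have h1 : Tendsto (fun x : ℝ => Real.log δ / Real.log x + 1 +
      Real.log (Real.log x) / Real.log x) atTop (nhds (0 + 1 + 0)) := by
    refine ((Real.tendsto_log_atTop.const_div_atTop _).add_const 1).add ?_
    exact (Real.isLittleO_log_id_atTop.tendsto_div_nhds_zero).comp Real.tendsto_log_atTop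
  simp only [zero_add, add_zero] at h1
  refine h1.congr' ?_
  filter_upwards [eventually_gt_atTop 1] with x hx
  have hl : 0 < Real.log x := Real.log_pos hx
  have hx0 : 0 < x := by linarith
  rw [div_inv_eq_mul, Real.log_mul hδ.ne' (by positivity), Real.log_mul hx0.ne' hl.ne']
  field_simp
  ring

theorem tendsto_mul_integral_exp_sub_one_mul {k ψ : ℝ}
    (hKm : AEStronglyMeasurable K (volume.restrict (Ico 0 1)))
    (hK0 : ∀ u ∈ Ico (0 : ℝ) 1, 0 ≤ K u) (hKC : ∀ u ∈ Ico (0 : ℝ) 1, K u ≤ C)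
    (hφ : IntegrableOn φ (Ico 0 1)) (hφ0 : ∀ u ∈ Ico (0 : ℝ) 1, 0 ≤ φ u)
    (hKlim : Tendsto K (nhdsWithin 1 (Iio 1)) (nhds k))
    (hφlim : Tendsto φ (nhdsWithin 1 (Iio 1)) (nhds ψ)) :
    Tendsto (fun x : ℝ => x * ∫ u in Ico (0 : ℝ) 1,
        (Real.exp (-((x * Real.log x)⁻¹ * (K u * (1 - u)⁻¹))) - 1) * φ u)
      atTop (nhds (-(k * ψ))) := by
  rw [Metric.tendsto_nhds]
  intro η hη
  set ε := η / 4 with hεdef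
  have hε : 0 < ε := by positivity
  have hev : ∀ᶠ u in nhdsWithin (1 : ℝ) (Iio 1), φ u ≤ ψ + 1 ∧ |K u * φ u - k * ψ| ≤ ε :=
    (hφlim.eventually (eventually_le_nhds (by linarith))).and
      (((hKlim.mul hφlim).eventually (Metric.ball_mem_nhds _ hε)).mono fun u hu => le_of_lt hu)
  obtain ⟨r, hr, hr'⟩ := (mem_nhdsLT_iff_exists_Ico_subset).1 hev
  obtain ⟨δ, hδ0, hδ1, hδr⟩ : ∃ δ : ℝ, 0 < δ ∧ δ ≤ 1 ∧ δ ≤ 1 - r :=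
    ⟨min 1 (1 - r), lt_min one_pos (sub_pos.2 hr), min_le_left _ _, min_le_right _ _⟩
  have hsub : ∀ u ∈ Ico (1 - δ) 1, φ u ≤ ψ + 1 ∧ |K u * φ u - k * ψ| ≤ ε := fun u hu =>
    hr' ⟨by linarith [hu.1], hu.2⟩
  set D := C * δ⁻¹ * (∫ u in Ico 0 1, φ u) + (ψ + 1) + (ψ + 1) * C ^ 2
  have hlog := tendsto_log_mul_log_div_log hδ0
  have hD : Tendsto (fun x : ℝ => D / Real.log x + ε *
      (Real.log (δ / (x * Real.log x)⁻¹) / Real.log x) + |k * ψ| *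
      |Real.log (δ / (x * Real.log x)⁻¹) / Real.log x - 1|) atTop
      (nhds (0 + ε * 1 + |k * ψ| * |(1 : ℝ) - 1|)) :=
    ((Real.tendsto_log_atTop.const_div_atTop D).add (hlog.const_mul ε)).add
      ((hlog.sub_const 1).abs.const_mul _)
  have hsmall : Tendsto (fun x : ℝ => (x * Real.log x)⁻¹) atTop (nhds 0) :=
    (tendsto_id.atTop_mul_atTop₀ Real.tendsto_log_atTop).inv_tendsto_atTop
  have hη' : 0 + ε * 1 + |k * ψ| * |(1 : ℝ) - 1| < η := by
    rw [sub_self, abs_zero]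
    linarith
  filter_upwards [hD.eventually (eventually_lt_nhds hη'),
    hsmall.eventually (eventually_le_nhds hδ0), eventually_gt_atTop 1] with x hx1 hx2 hx3
  have hl : 0 < Real.log x := Real.log_pos hx3
  have hx0 : 0 < x := by linarith
  have key := abs_integral_exp_sub_one_mul_add_le hKm hK0 hKC hφ hφ0
    (a := (x * Real.log x)⁻¹) (by positivity) hx2 hδ1 (fun u hu => (hsub u hu).1)
    (fun u hu => (hsub u hu).2)
  set J := ∫ u in Ico (0 : ℝ) 1,
    (Real.exp (-((x * Real.log x)⁻¹ * (K u * (1 - u)⁻¹))) - 1) * φ u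
  set R := Real.log (δ / (x * Real.log x)⁻¹)
  have key2 : |x * J + k * ψ * (R / Real.log x)| ≤ D / Real.log x + ε * (R / Real.log x) := by
    have h := mul_le_mul_of_nonneg_left key hx0.le
    rw [← abs_of_pos hx0, ← abs_mul, abs_of_pos hx0] at h
    have hleft : x * (J + (x * Real.log x)⁻¹ * (k * ψ) * R) =
        x * J + k * ψ * (R / Real.log x) := by field_simp
    have hright : x * ((x * Real.log x)⁻¹ * (D + ε * R)) =
        D / Real.log x + ε * (R / Real.log x) := by field_simp
    rwa [hleft, hright] at h
  rw [Real.dist_eq]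
  have e : x * J - -(k * ψ) = (x * J + k * ψ * (R / Real.log x)) -
      k * ψ * (R / Real.log x - 1) := by ring
  rw [e]
  refine (abs_sub _ _).trans_lt ?_
  rw [abs_mul (k * ψ)]
  linarith

end Laplace

section Kar

variable {α : ℝ} (d : ℕ) (θ : ℤ → ℝ)

lemma continuous_cNA (s : ℤ) : Continuous fun u => cNA d θ u s := by
  unfold cNA
  refine continuous_finsetSum _ fun t _ => ?_
  split_ifs <;> fun_prop

lemma cNA_one_sub_natCast (u : ℝ) (n : ℕ) : cNA d θ u (1 - n) = u ^ n * cNA d θ u 1 := by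
  unfold cNA
  rw [Finset.mul_sum]
  refine Finset.sum_congr rfl fun t ht => ?_
  have ht1 := (Finset.mem_Icc.1 ht).1
  rw [if_pos (by lia), if_pos ht1, show (t - (1 - n : ℤ)).toNat = n + (t - 1).toNat by lia, pow_add]
  ring

lemma cNA_of_lt (u : ℝ) {s : ℤ} (hs : (d : ℤ) < s) : cNA d θ u s = 0 :=
  Finset.sum_eq_zero fun t ht => if_neg (by have := (Finset.mem_Icc.1 ht).2; lia)

lemma cNA_one_one : cNA d θ 1 1 = ∑ t ∈ Finset.Icc (1 : ℤ) (d : ℤ), θ t :=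
  Finset.sum_congr rfl fun t ht => by simp [(Finset.mem_Icc.1 ht).1]

lemma tsum_abs_cNA_rpow (hα : 0 < α) {u : ℝ} (hu : u ∈ Ico (0 : ℝ) 1) :
    ∑' s : ℤ, |cNA d θ u s| ^ α =
      (1 - u ^ α)⁻¹ * |cNA d θ u 1| ^ α + ∑ s ∈ Finset.Icc (2 : ℤ) d, |cNA d θ u s| ^ α := by
  set f : ℤ → ℝ := fun s => |cNA d θ u s| ^ α
  have hinj : Function.Injective fun n : ℕ => (1 - n : ℤ) := fun m n h => by
    simp only at h; lia
  have h1 : HasSum (indicator (Iic 1) f) ((1 - u ^ α)⁻¹ * |cNA d θ u 1| ^ α) := by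
    rw [← hinj.hasSum_iff]
    · refine ((hasSum_geometric_of_lt_one (Real.rpow_nonneg hu.1 α)
        (Real.rpow_lt_one hu.1 hu.2 hα)).mul_right (|cNA d θ u 1| ^ α)).congr_fun fun n => ?_
      have hn : (1 - n : ℤ) ∈ Iic (1 : ℤ) := by simp
      rw [Function.comp_apply, indicator_of_mem hn]
      simp only [f]
      rw [cNA_one_sub_natCast, abs_mul, abs_of_nonneg (pow_nonneg hu.1 n),
        Real.mul_rpow (pow_nonneg hu.1 n) (abs_nonneg _), Real.rpow_pow_comm hu.1]
    · intro s hs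
      refine indicator_of_notMem (fun h => hs ⟨(1 - s).toNat, ?_⟩) f
      simp only [mem_Iic] at h
      simp only
      lia
  have h2 : HasSum (indicator (Iic 1)ᶜ f) (∑ s ∈ Finset.Icc (2 : ℤ) d, f s) := by
    have : ∑ s ∈ Finset.Icc (2 : ℤ) d, f s =
        ∑ s ∈ Finset.Icc (2 : ℤ) d, indicator (Iic 1)ᶜ f s :=
      Finset.sum_congr rfl fun s hs => (indicator_of_mem (by
        have := (Finset.mem_Icc.1 hs).1
        simp only [mem_compl_iff, mem_Iic]; lia) f).symm
    rw [this]
    refine hasSum_sum_of_ne_finset_zero fun s hs => ?_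
    by_cases h : s ≤ 1
    · exact indicator_of_notMem (by simpa using h) f
    · rw [indicator_of_mem (by simpa using h)]
      simp only [f]
      rw [cNA_of_lt d θ u (by simp only [Finset.mem_Icc] at hs; lia), abs_zero,
        Real.zero_rpow hα.ne']
  have h := h1.add h2
  simp only [← Pi.add_apply] at h
  rw [indicator_self_add_compl] at h
  exact h.tsum_eq

lemma Kar_eq (hα : 0 < α) {u : ℝ} (hu : u ∈ Ico (0 : ℝ) 1) :
    Kar α d θ u = (1 - u) * (1 - u ^ α)⁻¹ * |cNA d θ u 1| ^ α +
      (1 - u) * ∑ s ∈ Finset.Icc (2 : ℤ) d, |cNA d θ u s| ^ α := by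
  rw [Kar, tsum_abs_cNA_rpow d θ hα hu]
  ring

lemma continuous_abs_cNA_rpow (hα : 0 < α) (s : ℤ) : Continuous fun u => |cNA d θ u s| ^ α :=
  (continuous_cNA d θ s).abs.rpow_const fun _ => Or.inr hα.le

lemma continuousOn_Kar (hα : 0 < α) : ContinuousOn (Kar α d θ) (Ico 0 1) := by
  refine ContinuousOn.congr ?_ fun u hu => Kar_eq d θ hα hu
  have h1 := continuous_abs_cNA_rpow d θ hα 1
  have h2 : Continuous fun u => ∑ s ∈ Finset.Icc (2 : ℤ) d, |cNA d θ u s| ^ α :=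
    continuous_finsetSum _ fun s _ => continuous_abs_cNA_rpow d θ hα s
  have h3 : ContinuousOn (fun u : ℝ => (1 - u ^ α)⁻¹) (Ico 0 1) := by
    refine ContinuousOn.inv₀ (continuousOn_const.sub
      (Real.continuous_rpow_const hα.le).continuousOn) fun u hu => ?_
    exact (sub_pos.2 (Real.rpow_lt_one hu.1 hu.2 hα)).ne'
  exact (((continuousOn_const.sub continuousOn_id).mul h3).mul h1.continuousOn).add
    ((continuousOn_const.sub continuousOn_id).mul h2.continuousOn)

lemma Kar_nonneg {u : ℝ} (hu : u ≤ 1) : 0 ≤ Kar α d θ u :=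
  mul_nonneg (by linarith) (tsum_nonneg fun _ => Real.rpow_nonneg (abs_nonneg _) _)

lemma exists_Kar_le (hα : 1 ≤ α) : ∃ C, ∀ u ∈ Ico (0 : ℝ) 1, Kar α d θ u ≤ C := by
  have hα0 : 0 < α := by linarith
  have hc : Continuous fun u => |cNA d θ u 1| ^ α +
      ∑ s ∈ Finset.Icc (2 : ℤ) d, |cNA d θ u s| ^ α :=
    (continuous_abs_cNA_rpow d θ hα0 1).add
      (continuous_finsetSum _ fun s _ => continuous_abs_cNA_rpow d θ hα0 s)
  obtain ⟨C, hC⟩ := (isCompact_Icc (a := (0 : ℝ)) (b := 1)).bddAbove_image hc.continuousOn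
  refine ⟨C, fun u hu => le_trans ?_ (hC (mem_image_of_mem _ (Ico_subset_Icc_self hu)))⟩
  rw [Kar_eq d θ hα0 hu]
  have hpow : u ^ α ≤ u := by
    simpa using Real.rpow_le_rpow_of_exponent_ge' hu.1 hu.2.le zero_le_one hα
  have hpos : 0 < 1 - u ^ α := by linarith [hu.2]
  have h1 : (1 - u) * (1 - u ^ α)⁻¹ ≤ 1 := by
    rw [← div_eq_mul_inv, div_le_one hpos]; linarith
  refine add_le_add (mul_le_of_le_one_left (Real.rpow_nonneg (abs_nonneg _) _) h1)
    (mul_le_of_le_one_left (Finset.sum_nonneg fun _ _ => Real.rpow_nonneg (abs_nonneg _) _) ?_)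
  linarith [hu.1]

lemma tendsto_one_sub_mul_inv_one_sub_rpow (hα : α ≠ 0) :
    Tendsto (fun u : ℝ => (1 - u) * (1 - u ^ α)⁻¹) (nhdsWithin 1 (Iio 1)) (nhds α⁻¹) := by
  have h := (Real.hasDerivAt_rpow_const (x := 1) (p := α) (Or.inl one_ne_zero)).tendsto_slope
  simp only [Real.one_rpow, mul_one] at h
  refine ((h.mono_left (nhdsWithin_mono 1 fun u hu => ne_of_lt hu)).inv₀ hα).congr fun u => ?_
  rw [slope_def_field, Real.one_rpow, inv_div, ← div_eq_mul_inv, ← neg_sub 1 u,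
    ← neg_sub 1 (u ^ α), neg_div_neg_eq]

lemma tendsto_Kar (hα : 0 < α) :
    Tendsto (Kar α d θ) (nhdsWithin 1 (Iio 1))
      (nhds (α⁻¹ * |∑ t ∈ Finset.Icc (1 : ℤ) (d : ℤ), θ t| ^ α)) := by
  have h2 : Continuous fun u => (1 - u) * ∑ s ∈ Finset.Icc (2 : ℤ) d, |cNA d θ u s| ^ α :=
    (continuous_const.sub continuous_id).mul
      (continuous_finsetSum _ fun s _ => continuous_abs_cNA_rpow d θ hα s)
  have h := ((tendsto_one_sub_mul_inv_one_sub_rpow hα.ne').mul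
    ((continuous_abs_cNA_rpow d θ hα 1).tendsto 1 |>.mono_left nhdsWithin_le_nhds)).add
    ((h2.tendsto 1).mono_left nhdsWithin_le_nhds)
  simp only [sub_self, zero_mul, add_zero, cNA_one_one] at h
  refine h.congr' ?_
  filter_upwards [Ico_mem_nhdsLT (zero_lt_one (α := ℝ))] with u hu
  exact (Kar_eq d θ hα hu).symm

end Kar

/-- the analytic core (4.4) of the iterated limit (2.13) of Theorem 2.1
for the boundary case `β = 1 < α` (simplified symmetric setting `h ≡ 1`, `ω ≡ 1`). -/
theorem stmt_8 (α : ℝ) (hα1 : 1 < α) (hα2 : α ≤ 2) (d : ℕ) (hd : 0 < d) (θ : ℤ → ℝ)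
    (φ : ℝ → ℝ) (ψ₁ : ℝ) (hψ₁ : 0 < ψ₁)
    (hφint : MeasureTheory.IntegrableOn φ (Set.Ico 0 1))
    (hφnn : ∀ u ∈ Set.Ico (0:ℝ) 1, 0 ≤ φ u)
    (hφ1 : (∫ u in Set.Ico (0:ℝ) 1, φ u) = 1)
    (hφlim : Filter.Tendsto φ (nhdsWithin 1 (Set.Iio 1)) (nhds ψ₁)) :
    Filter.Tendsto (fun N : ℕ =>
        (N : ℝ) * ∫ u in Set.Ico (0:ℝ) 1,
          (Real.exp (-(Kar α d θ u) / ((1 - u) * (N : ℝ) * Real.log N)) - 1) * φ u)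
      Filter.atTop
      (nhds (-(ψ₁ / α) * |∑ t ∈ Finset.Icc (1 : ℤ) (d : ℤ), θ t| ^ α)) := by
  have hα0 : 0 < α := by linarith
  obtain ⟨C, hC⟩ := exists_Kar_le d θ hα1.le
  have h := (tendsto_mul_integral_exp_sub_one_mul
    ((continuousOn_Kar d θ hα0).aestronglyMeasurable measurableSet_Ico)
    (fun u hu => Kar_nonneg d θ hu.2.le) hC hφint hφnn (tendsto_Kar d θ hα0) hφlim).comp
    tendsto_natCast_atTop_atTop
  convert h using 2 with N
  · simp only [Function.comp_apply]
    congr 1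
    refine integral_congr_ae (Eventually.of_forall fun u => ?_)
    simp only
    congr 3
    rw [mul_assoc (1 - u), neg_div, div_eq_mul_inv, mul_inv]
    ring
  · ring
end
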